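/- (Inference on near-winners.) Suppose 𝐒 : [0,∞)^m → [0,∞) is continuous, strictly decreasing in each coordinate, tends to 0 as min_j v_j → ∞, and is symmetric in the entries of its argument (𝐒(v) = 𝐒(v_σ) for every permutation σ). Let X ∈ ℝ^m have a unique maximizer î, let Ĉ^α_î = { θ_î : θ ∈ ℝ^m, X ∈ A_α(θ) }, and let r_l = X_î − min Ĉ^α_î and r_u = max Ĉ^α_î − X_î. For any index j ∈ [m] with Δ̂_j = X_î − X_j, the projection Ĉ^α_j = { θ_j : θ ∈ ℝ^m, X ∈ A_α(θ) } satisfies Ĉ^α_j ⊆ ( [X_î − 3 r_l, X_î + r_u] ∩ [X_j − r_l, X_j + r_l] ) ∪ [ X_j − Δ̂_j − r_u, X_j + (Δ̂_j + r_u)/3 ]. -/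

import Mathlib

open Set

noncomputable section

/-- Suboptimality gap `Δ_j(θ) = max_i θ_i − θ_j`. -/
def gapv {m : ℕ} (θ : Fin m → ℝ) (j : Fin m) : ℝ := (⨆ i, θ i) - θ j

/-- Active radius `r_α(θ) = min {r ≥ 0 : 𝐒((max{r, Δ_j(θ)/2})_j) ≤ α}`. -/
def rA {m : ℕ} (S : (Fin m → ℝ) → ℝ) (α : ℝ) (θ : Fin m → ℝ) : ℝ :=
  sInf {r : ℝ | 0 ≤ r ∧ S (fun j => max r (gapv θ j / 2)) ≤ α}

/-- Acceptance-region membership: `x ∈ A_α(θ)`. -/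
def accept {m : ℕ} (S : (Fin m → ℝ) → ℝ) (α : ℝ) (θ x : Fin m → ℝ) : Prop :=
  ∀ j, |x j - θ j| ≤ max (rA S α θ) (gapv θ j / 2)

/-- The worst-case vector `θ^t`: `θ^t_î = t`, `θ^t_j = min{(2/3)X_j + (1/3)t, t}`
for `j ≠ î`. -/
def thetaT {m : ℕ} (X : Fin m → ℝ) (ih : Fin m) (t : ℝ) : Fin m → ℝ :=
  fun j => if j = ih then t else min (2 / 3 * X j + 1 / 3 * t) t

/-- The zoom-correction confidence set `Ĉ^α_î = {t : |X_î − t| ≤ r_α(θ^t)}`. -/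
def Chat {m : ℕ} (S : (Fin m → ℝ) → ℝ) (α : ℝ) (X : Fin m → ℝ) (ih : Fin m) : Set ℝ :=
  {t : ℝ | |X ih - t| ≤ rA S α (thetaT X ih t)}

/-- Projection of the inverted zoom test along coordinate `j`:
`Ĉ^α_j = {θ_j : X ∈ A_α(θ)}`. -/
def proj {m : ℕ} (S : (Fin m → ℝ) → ℝ) (α : ℝ) (X : Fin m → ℝ) (j : Fin m) : Set ℝ :=
  {s : ℝ | ∃ θ : Fin m → ℝ, accept S α θ X ∧ s = θ j}

lemma aux_anti {m : ℕ} (S : (Fin m → ℝ) → ℝ)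
    (hSanti : ∀ v : Fin m → ℝ, (∀ j, 0 ≤ v j) → ∀ (j : Fin m) (a b : ℝ),
      0 ≤ a → a < b → S (Function.update v j b) < S (Function.update v j a))
    (v w : Fin m → ℝ) (hv : ∀ j, 0 ≤ v j) (hvw : ∀ j, v j ≤ w j) : S w ≤ S v := by
  classical
  have key : ∀ s : Finset (Fin m), S (fun j => if j ∈ s then w j else v j) ≤ S v := by
    intro s
    induction s using Finset.induction_on with
    | empty => simp
    | insert a s ha ih =>
      refine le_trans ?_ ih
      set u : Fin m → ℝ := fun j => if j ∈ s then w j else v j with hu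
      have hu0 : ∀ j, 0 ≤ u j := by
        intro j
        simp only [hu]
        split_ifs
        · exact (hv j).trans (hvw j)
        · exact hv j
      have e1 : (fun j => if j ∈ insert a s then w j else v j) = Function.update u a (w a) := by
        funext j
        by_cases h : j = a
        · subst h; simp
        · simp [h, hu]
      have e2 : u = Function.update u a (v a) := by
        funext j
        by_cases h : j = a
        · subst h; simp [hu, ha]
        · simp [h]
      rw [e1]
      rcases (hvw a).eq_or_lt with h | h
      · rw [← h, ← e2]
      · conv_rhs => rw [e2]
        exact (hSanti u hu0 a _ _ (hv a) h).le
  simpa using key Finset.univ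

lemma aux_strict {m : ℕ} (S : (Fin m → ℝ) → ℝ)
    (hSanti : ∀ v : Fin m → ℝ, (∀ j, 0 ≤ v j) → ∀ (j : Fin m) (a b : ℝ),
      0 ≤ a → a < b → S (Function.update v j b) < S (Function.update v j a))
    (v w : Fin m → ℝ) (hv : ∀ j, 0 ≤ v j) (hvw : ∀ j, v j ≤ w j) (i : Fin m)
    (hi : v i < w i) : S w < S v := by
  have h1 : S w ≤ S (Function.update v i (w i)) := by
    apply aux_anti S hSanti
    · intro j
      by_cases h : j = i
      · subst h; simpa using (hv j).trans (hvw j)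
      · simpa [h] using hv j
    · intro j
      by_cases h : j = i
      · subst h; simp
      · simpa [h] using hvw j
  have h2 := hSanti v hv i _ _ (hv i) hi
  rw [Function.update_eq_self] at h2
  exact h1.trans_lt h2

lemma gapv_nonneg {m : ℕ} (θ : Fin m → ℝ) (j : Fin m) : 0 ≤ gapv θ j := by
  unfold gapv
  linarith [le_ciSup (Set.finite_range θ).bddAbove j]

lemma rA_nonneg {m : ℕ} (S : (Fin m → ℝ) → ℝ) (α : ℝ) (θ : Fin m → ℝ) : 0 ≤ rA S α θ :=
  Real.sInf_nonneg (fun _ h => h.1)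

lemma rA_le {m : ℕ} (S : (Fin m → ℝ) → ℝ) (α : ℝ) (θ : Fin m → ℝ) (r : ℝ) (h0 : 0 ≤ r)
    (h : S (fun j => max r (gapv θ j / 2)) ≤ α) : rA S α θ ≤ r :=
  csInf_le ⟨0, fun _ h => h.1⟩ ⟨h0, h⟩

lemma rA_val {m : ℕ} (S : (Fin m → ℝ) → ℝ) (α : ℝ) (θ : Fin m → ℝ)
    (hScont : ContinuousOn S {v : Fin m → ℝ | ∀ j, 0 ≤ v j})
    (hpos : 0 < rA S α θ) : α ≤ S (fun j => max (rA S α θ) (gapv θ j / 2)) := by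
  by_contra hlt
  push Not at hlt
  set r := rA S α θ with hr
  have hc : Continuous (fun s : ℝ => (fun j => max s (gapv θ j / 2) : Fin m → ℝ)) := by
    fun_prop
  have hc2 : Continuous (fun s : ℝ => S (fun j => max s (gapv θ j / 2))) := by
    refine hScont.comp_continuous hc ?_
    intro s j
    exact le_max_of_le_right (by linarith [gapv_nonneg θ j])
  have hev : ∀ᶠ s in nhds r, S (fun j => max s (gapv θ j / 2)) < α :=
    hc2.continuousAt.eventually_lt continuousAt_const hlt
  obtain ⟨ε, hε, hb⟩ := Metric.eventually_nhds_iff.1 hev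
  have h0 : 0 ≤ max 0 (r - ε / 2) := le_max_left _ _
  have hlt' : max 0 (r - ε / 2) < r := max_lt hpos (by linarith)
  have hd : dist (max 0 (r - ε / 2)) r < ε := by
    rw [Real.dist_eq, abs_lt]
    constructor
    · linarith [le_max_right 0 (r - ε / 2)]
    · linarith
  have := rA_le S α θ _ h0 (hb hd).le
  linarith

lemma exists_top {m : ℕ} [Nonempty (Fin m)] (θ : Fin m → ℝ) : ∃ k, θ k = ⨆ i, θ i :=
  exists_eq_ciSup_of_finite

/-- **Inference on near-winners.** For symmetric `𝐒` and any (possibly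
data-dependent) index `j`, with `r_l = X_î − min Ĉ^α_î`, `r_u = max Ĉ^α_î − X_î`
and `Δ̂_j = X_î − X_j`, the projection `Ĉ^α_j` is contained in
`([X_î − 3r_l, X_î + r_u] ∩ [X_j − r_l, X_j + r_l]) ∪
 [X_j − Δ̂_j − r_u, X_j + (Δ̂_j + r_u)/3]`. -/
theorem near_winner_projection_bound
    (m : ℕ) (hm : 0 < m) (α : ℝ) (hα0 : 0 < α) (hα1 : α < 1)
    (S : (Fin m → ℝ) → ℝ)
    (hS0 : ∀ v : Fin m → ℝ, (∀ j, 0 ≤ v j) → 0 ≤ S v)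
    (hScont : ContinuousOn S {v : Fin m → ℝ | ∀ j, 0 ≤ v j})
    (hSanti : ∀ v : Fin m → ℝ, (∀ j, 0 ≤ v j) → ∀ (j : Fin m) (a b : ℝ),
      0 ≤ a → a < b → S (Function.update v j b) < S (Function.update v j a))
    (hSlim : ∀ ε : ℝ, 0 < ε → ∃ M : ℝ, ∀ v : Fin m → ℝ, (∀ j, M ≤ v j) → S v < ε)
    (hSsym : ∀ (σ : Equiv.Perm (Fin m)) (v : Fin m → ℝ), S (v ∘ σ) = S v)
    (X : Fin m → ℝ) (ih : Fin m) (hih : ∀ j, j ≠ ih → X j < X ih)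
    (rl ru : ℝ)
    (hrl : rl = X ih - sInf (proj S α X ih))
    (hru : ru = sSup (proj S α X ih) - X ih)
    (j : Fin m) :
    proj S α X j ⊆
      (Set.Icc (X ih - 3 * rl) (X ih + ru) ∩ Set.Icc (X j - rl) (X j + rl)) ∪
      Set.Icc (X j - (X ih - X j) - ru) (X j + ((X ih - X j) + ru) / 3) := by
  classical
  have : Nonempty (Fin m) := ⟨ih⟩
  have hXle : ∀ i, X i ≤ X ih := by
    intro i
    by_cases h : i = ih
    · rw [h]
    · exact (hih i h).le
  have hle : ∀ (θ : Fin m → ℝ) i, θ i ≤ ⨆ i, θ i :=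
    fun θ i => le_ciSup (Set.finite_range θ).bddAbove i
  obtain ⟨R, hR⟩ := hSlim α hα0
  have hrR : ∀ θ, rA S α θ ≤ max R 0 := fun θ =>
    rA_le S α θ _ (le_max_right _ _)
      (hR _ (fun j => (le_max_left R 0).trans (le_max_left _ _))).le
  -- top bound
  have htop : ∀ θ, accept S α θ X → (⨆ i, θ i) ≤ X ih + rA S α θ := by
    intro θ hθ
    obtain ⟨k, hk⟩ := exists_top θ
    have h := hθ k
    have : gapv θ k = 0 := by simp [gapv, hk]
    rw [this, zero_div, max_eq_left (rA_nonneg S α θ), abs_le] at h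
    linarith [hXle k]
  have hlow : ∀ θ, accept S α θ X → X ih - rA S α θ ≤ ⨆ i, θ i := by
    intro θ hθ
    have h := hθ ih
    have h1 := hle θ ih
    rcases le_max_iff.1 h with h | h
    · rw [abs_le] at h; linarith
    · rw [abs_le, gapv] at h
      linarith [rA_nonneg S α θ]
  have hlow2 : ∀ θ, accept S α θ X → X ih - max R 0 ≤ θ ih := by
    intro θ hθ
    have h := hθ ih
    have h1 := htop θ hθ
    have h2 := hrR θ
    rcases le_max_iff.1 h with h | h
    · rw [abs_le] at h; linarith
    · rw [abs_le, gapv] at h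
      linarith [rA_nonneg S α θ]
  have hbb : BddBelow (proj S α X ih) := by
    refine ⟨X ih - max R 0, ?_⟩
    rintro s ⟨θ, hθ, rfl⟩
    exact hlow2 θ hθ
  have hba : BddAbove (proj S α X ih) := by
    refine ⟨X ih + max R 0, ?_⟩
    rintro s ⟨θ, hθ, rfl⟩
    linarith [hle θ ih, htop θ hθ, hrR θ]
  have hXin : X ih ∈ proj S α X ih := by
    refine ⟨X, fun i => ?_, rfl⟩
    simp only [sub_self, abs_zero]
    exact le_max_of_le_left (rA_nonneg S α X)
  have hru0 : 0 ≤ ru := by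
    have := le_csSup hba hXin
    linarith
  -- Claim A
  have hA : ∀ θ, accept S α θ X → (⨆ i, θ i) ≤ X ih + ru := by
    intro θ hθ
    by_cases hM : (⨆ i, θ i) ≤ X ih
    · linarith
    push Not at hM
    obtain ⟨k, hk⟩ := exists_top θ
    have hkk := hθ k
    have hg0 : gapv θ k = 0 := by simp [gapv, hk]
    rw [hg0, zero_div, max_eq_left (rA_nonneg S α θ), abs_le, hk] at hkk
    set σ := Equiv.swap ih k with hσ
    have hsup : (⨆ i, (θ ∘ σ) i) = ⨆ i, θ i := σ.iSup_comp (g := θ)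
    have hgap : ∀ i, gapv (θ ∘ σ) i = gapv θ (σ i) := by
      intro i; rw [gapv, hsup]; rfl
    have hrr : rA S α (θ ∘ σ) = rA S α θ := by
      unfold rA
      congr 1
      ext r
      simp only [Set.mem_setOf_eq, hgap]
      rw [← hSsym σ (fun j => max r (gapv θ j / 2))]
      rfl
    have hmem : (⨆ i, θ i) ∈ proj S α X ih := by
      refine ⟨θ ∘ σ, fun i => ?_, by simp [hσ, hk]⟩
      rw [hrr, hgap]
      simp only [Function.comp]
      by_cases h1 : i = ih
      · subst h1
        simp only [hσ, Equiv.swap_apply_left, hk]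
        refine le_max_of_le_left ?_
        rw [abs_le]
        constructor <;> linarith [hXle k, rA_nonneg S α θ]
      by_cases h2 : i = k
      · subst h2
        simp only [hσ, Equiv.swap_apply_right]
        have h3 := hθ ih
        rw [abs_le] at h3 ⊢
        constructor
        · linarith [hle θ ih, le_max_left (rA S α θ) (gapv θ ih / 2)]
        · linarith [hXle i]
      · rw [hσ, Equiv.swap_apply_of_ne_of_ne h1 h2]
        exact hθ i
    have := le_csSup hba hmem
    linarith
  -- Claim B
  have hB : ∀ θ, accept S α θ X → rA S α θ ≤ rl := by
    intro θ hθ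
    set r := rA S α θ with hr
    have hr0 : 0 ≤ r := rA_nonneg S α θ
    suffices hmem : X ih - r ∈ proj S α X ih by
      have := csInf_le hbb hmem
      linarith
    set t := X ih - r with ht
    set θ' : Fin m → ℝ := fun i => min t ((2 * X i + t) / 3) with hθ'
    have hih' : θ' ih = t := by
      simp only [hθ']
      apply min_eq_left
      linarith
    have hsup : (⨆ i, θ' i) = t := by
      apply le_antisymm
      · exact ciSup_le (fun i => min_le_left _ _)
      · rw [← hih']; exact hle θ' ih
    have hgap : ∀ i, gapv θ' i = t - θ' i := by
      intro i; rw [gapv, hsup]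
    have hMt := hlow θ hθ
    have hcmp : ∀ i, max r (gapv θ' i / 2) ≤ max r (gapv θ i / 2) := by
      intro i
      refine max_le (le_max_left _ _) ?_
      rw [hgap]
      have h := hθ i
      rcases le_total t ((2 * X i + t) / 3) with h1 | h1
      · have : θ' i = t := min_eq_left h1
        rw [this]
        exact le_max_of_le_left (by linarith)
      · have h4 : θ' i = (2 * X i + t) / 3 := min_eq_right h1
        rw [h4]
        rcases le_total r (gapv θ i / 2) with h2 | h2
        · rw [max_eq_right h2] at h ⊢
          rw [abs_le] at h
          simp only [gapv] at *
          linarith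
        · rw [max_eq_left h2] at h ⊢
          rw [abs_le] at h
          simp only [gapv] at *
          linarith
    have hrr : r ≤ rA S α θ' := by
      rcases hr0.eq_or_lt with h0 | hpos
      · rw [← h0]; exact rA_nonneg S α θ'
      refine le_csInf ⟨max R 0, le_max_right _ _,
        (hR _ (fun j => (le_max_left R 0).trans (le_max_left _ _))).le⟩ ?_
      rintro s ⟨hs0, hs⟩
      by_contra hsr
      push Not at hsr
      have h1 : α ≤ S (fun j => max r (gapv θ j / 2)) := rA_val S α θ hScont hpos
      have h2 := aux_anti S hSanti _ _ (fun j => le_max_of_le_left hr0) hcmp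
      have h3 := aux_strict S hSanti (fun j => max s (gapv θ' j / 2))
        (fun j => max r (gapv θ' j / 2)) (fun j => le_max_of_le_left hs0)
        (fun j => max_le_max_right _ hsr.le) ih (by
          have : gapv θ' ih = 0 := by rw [hgap, hih', sub_self]
          simp only [this, zero_div]
          rw [max_eq_left hs0, max_eq_left hr0]
          exact hsr)
      linarith
    refine ⟨θ', fun i => ?_, hih'.symm⟩
    rw [hgap]
    rcases le_total t ((2 * X i + t) / 3) with h1 | h1
    · have : θ' i = t := min_eq_left h1
      rw [this]
      refine le_max_of_le_left ?_
      rw [abs_le]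
      constructor <;> linarith [hXle i]
    · have h4 : θ' i = (2 * X i + t) / 3 := min_eq_right h1
      rw [h4]
      refine le_max_of_le_right ?_
      rw [abs_le]
      constructor <;> linarith
  rintro s ⟨θ, hθ, rfl⟩
  have h := hθ j
  have hAθ := hA θ hθ
  have hBθ := hB θ hθ
  have hL := hlow θ hθ
  have hj := hle θ j
  rcases le_total (rA S α θ) (gapv θ j / 2) with h2 | h2
  · right
    rw [max_eq_right h2, abs_le] at h
    simp only [gapv] at *
    constructor <;> linarith
  · left
    rw [max_eq_left h2, abs_le] at h
    simp only [gapv] at *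
    refine ⟨⟨?_, ?_⟩, ?_, ?_⟩ <;> linarith
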